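/- arXiv:2003.01080 — 2 statements merged into one kernel-verified Lean document; each statement's English description precedes it below -/
import Mathlib

section
/- Let (g,[·,·],α) be a multiplicative Hom-Lie superalgebra over a field K of characteristic zero, n ≥ 3, let φ be an even super-skew-symmetric (n−2)-linear form on g satisfying the two conditions making (g,[·,…,·]_φ,α) a multiplicative n-Hom-Lie superalgebra, and let D be a homogeneous α^k-derivation of g (so D∘α = α∘D and D([x,y]) = [D(x),α^k(y)] + (−1)^{|D||x|}[α^k(x),D(y)]) such that Σ_{i=1}^{n−2} (−1)^{|D||X|^{i−1}} φ(x₁,…,D(xᵢ),…,x_{n−2}) = 0 for all homogeneous x₁,…,x_{n−2}, where |X|^{i−1} = |x₁|+⋯+|x_{i−1}|. Then D is an α^k-derivation of the n-Hom-Lie superalgebra (g,[·,…,·]_φ,α): D([x₁,…,xₙ]_φ) = Σ_{i=1}^{n} (−1)^{|D||X|^{i−1}} [α^k(x₁),…,D(xᵢ),…,α^k(xₙ)]_φ. -/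
namespace NHomSuper

/-- The sign `(-1)^d` associated to a degree `d : ℤ₂`. -/
def sgn (K : Type*) [Field K] (d : ZMod 2) : K := (-1 : K) ^ d.val

variable {K : Type*} [Field K] [CharZero K]
variable {V : Type*} [AddCommGroup V] [Module K V]

/-- Sum of the degrees of the entries strictly before position `i`:  `|X|^{i-1}`. -/
def partSum {n : ℕ} (d : Fin n → ZMod 2) (i : Fin n) : ZMod 2 :=
  ∑ j ∈ Finset.univ.filter (fun j => j < i), d j

/-- Sum of the degrees of the entries strictly after position `j`. -/
def sumAfter {n : ℕ} (d : Fin n → ZMod 2) (j : Fin n) : ZMod 2 :=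
  ∑ k ∈ Finset.univ.filter (fun k => j < k), d k

/-- Sum of the degrees of the entries strictly between positions `i` and `j`. -/
def sumBetween {n : ℕ} (d : Fin n → ZMod 2) (i j : Fin n) : ZMod 2 :=
  ∑ k ∈ Finset.univ.filter (fun k => i < k ∧ k < j), d k

/-- The exponent `γ^X_{ij} = (|x_i|+|x_j|)(|x_{j+1}|+⋯+|x_n|) + |x_i|(|x_{i+1}|+⋯+|x_{j-1}|)`. -/
def gamma {n : ℕ} (d : Fin n → ZMod 2) (i j : Fin n) : ZMod 2 :=
  (d i + d j) * sumAfter d j + d i * sumBetween d i j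

/-- The increasing embedding `Fin (m+1) → Fin (m+3)` omitting the two positions `i < j`. -/
def skip2 {m : ℕ} (i j : Fin (m + 3)) (k : Fin (m + 1)) : Fin (m + 3) :=
  if h1 : (k : ℕ) < (i : ℕ) then ⟨(k : ℕ), lt_trans h1 i.isLt⟩
  else if h2 : (k : ℕ) + 1 < (j : ℕ) then ⟨(k : ℕ) + 1, lt_trans h2 j.isLt⟩
  else ⟨(k : ℕ) + 2, by have hk := k.isLt; omega⟩

/-- A Hom-Lie superalgebra structure on the ℤ₂-graded vector space `V` with grading `gr`. -/
structure IsHomLieSuper (gr : ZMod 2 → Submodule K V)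
    (br : V →ₗ[K] V →ₗ[K] V) (α : Module.End K V) : Prop where
  internal : DirectSum.IsInternal gr
  alpha_even : ∀ (a : ZMod 2) (x : V), x ∈ gr a → α x ∈ gr a
  br_even : ∀ (a b : ZMod 2) (x y : V), x ∈ gr a → y ∈ gr b → br x y ∈ gr (a + b)
  skew : ∀ (a b : ZMod 2) (x y : V), x ∈ gr a → y ∈ gr b →
    br x y = - sgn K (a * b) • br y x
  jacobi : ∀ (a b c : ZMod 2) (x y z : V), x ∈ gr a → y ∈ gr b → z ∈ gr c →
    sgn K (a * c) • br (α x) (br y z) + sgn K (b * a) • br (α y) (br z x)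
      + sgn K (c * b) • br (α z) (br x y) = 0

/-- An even multilinear form: it vanishes on homogeneous tuples of nonzero total degree. -/
def FormEven (gr : ZMod 2 → Submodule K V) {p : ℕ}
    (φ : MultilinearMap K (fun _ : Fin p => V) K) : Prop :=
  ∀ (d : Fin p → ZMod 2) (x : Fin p → V), (∀ i, x i ∈ gr (d i)) →
    (∑ i, d i) ≠ 0 → φ x = 0

/-- A super-skew-symmetric multilinear form (adjacent transpositions). -/
def FormSuperSkew (gr : ZMod 2 → Submodule K V) {p : ℕ}
    (φ : MultilinearMap K (fun _ : Fin p => V) K) : Prop :=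
  ∀ (d : Fin p → ZMod 2) (x : Fin p → V), (∀ i, x i ∈ gr (d i)) →
    ∀ i j : Fin p, (j : ℕ) = (i : ℕ) + 1 →
      φ x = - sgn K (d i * d j) * φ (x ∘ Equiv.swap i j)

/-- The `n`-ary product `[x₁,…,xₙ]_φ` (here `n = m+3`) induced by a binary bracket `br`
and an `(n-2)`-cochain `φ`, for a homogeneous tuple `x` with degrees `d`. -/
def phiBr {m : ℕ} (br : V →ₗ[K] V →ₗ[K] V)
    (φ : MultilinearMap K (fun _ : Fin (m + 1) => V) K)
    (d : Fin (m + 3) → ZMod 2) (x : Fin (m + 3) → V) : V :=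
  ∑ p ∈ Finset.univ.filter (fun p : Fin (m + 3) × Fin (m + 3) => p.1 < p.2),
    ((-1 : K) ^ ((p.1 : ℕ) + (p.2 : ℕ) + 1) * sgn K (gamma d p.1 p.2)
      * φ (x ∘ skip2 p.1 p.2)) • br (x p.1) (x p.2)

/-- Condition `φ ∧ δφ_X = 0` of Theorem 2.9. -/
def PhiCond1 {m : ℕ} (gr : ZMod 2 → Submodule K V) (br : V →ₗ[K] V →ₗ[K] V)
    (φ : MultilinearMap K (fun _ : Fin (m + 1) => V) K) : Prop :=
  ∀ (dx : Fin m → ZMod 2) (x : Fin m → V) (dy : Fin (m + 3) → ZMod 2)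
      (y : Fin (m + 3) → V),
    (∀ i, x i ∈ gr (dx i)) → (∀ i, y i ∈ gr (dy i)) →
    ∑ p ∈ Finset.univ.filter (fun p : Fin (m + 3) × Fin (m + 3) => p.1 < p.2),
      (-1 : K) ^ ((p.1 : ℕ) + (p.2 : ℕ)) * sgn K (gamma dy p.1 p.2)
        * φ (y ∘ skip2 p.1 p.2) * φ (Fin.snoc x (br (y p.1) (y p.2))) = 0

/-- Condition `φ ∘ (α ⊗ Id ⊗ ⋯ ⊗ Id) = φ`. -/
def PhiCond2 {m : ℕ} (φ : MultilinearMap K (fun _ : Fin (m + 1) => V) K)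
    (α : Module.End K V) : Prop :=
  ∀ x : Fin (m + 1) → V, φ (Function.update x 0 (α (x 0))) = φ x

/-- A multiplicative `n`-Hom-Lie superalgebra structure (`n = m+3`) given by a
degree-parametrized `n`-linear bracket `B` on homogeneous tuples. -/
structure IsMultNHomLieSuperGr {m : ℕ} (gr : ZMod 2 → Submodule K V)
    (B : (Fin (m + 3) → ZMod 2) → (Fin (m + 3) → V) → V) (α : Module.End K V) : Prop where
  internal : DirectSum.IsInternal gr
  alpha_even : ∀ (a : ZMod 2) (x : V), x ∈ gr a → α x ∈ gr a
  map_add : ∀ (d : Fin (m + 3) → ZMod 2) (x : Fin (m + 3) → V) (i : Fin (m + 3)) (u v : V),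
    B d (Function.update x i (u + v)) = B d (Function.update x i u) + B d (Function.update x i v)
  map_smul : ∀ (d : Fin (m + 3) → ZMod 2) (x : Fin (m + 3) → V) (i : Fin (m + 3)) (c : K) (u : V),
    B d (Function.update x i (c • u)) = c • B d (Function.update x i u)
  even : ∀ (d : Fin (m + 3) → ZMod 2) (x : Fin (m + 3) → V), (∀ i, x i ∈ gr (d i)) →
    B d x ∈ gr (∑ i, d i)
  skew : ∀ (d : Fin (m + 3) → ZMod 2) (x : Fin (m + 3) → V), (∀ i, x i ∈ gr (d i)) →
    ∀ i j : Fin (m + 3), (j : ℕ) = (i : ℕ) + 1 →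
      B d x = - sgn K (d i * d j) • B (d ∘ Equiv.swap i j) (x ∘ Equiv.swap i j)
  mult : ∀ (d : Fin (m + 3) → ZMod 2) (x : Fin (m + 3) → V), (∀ i, x i ∈ gr (d i)) →
    α (B d x) = B d (fun i => α (x i))
  nambu : ∀ (dx : Fin (m + 2) → ZMod 2) (x : Fin (m + 2) → V)
      (dy : Fin (m + 3) → ZMod 2) (y : Fin (m + 3) → V),
      (∀ i, x i ∈ gr (dx i)) → (∀ i, y i ∈ gr (dy i)) →
    B (Fin.snoc dx (∑ i, dy i)) (Fin.snoc (fun i => α (x i)) (B dy y)) =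
      ∑ i : Fin (m + 3), sgn K ((∑ k, dx k) * partSum dy i) •
        B (Function.update dy i ((∑ k, dx k) + dy i))
          (Function.update (fun j => α (y j)) i (B (Fin.snoc dx (dy i)) (Fin.snoc x (y i))))

/-- An `n`-ary Hom-Nambu superalgebra structure (`n = p+2`) with (degree-free) bracket `nbr`. -/
structure IsNaryHomNambuSuper {p : ℕ} (gr : ZMod 2 → Submodule K V)
    (nbr : (Fin (p + 2) → V) → V) (β : Module.End K V) : Prop where
  internal : DirectSum.IsInternal gr
  alpha_even : ∀ (a : ZMod 2) (x : V), x ∈ gr a → β x ∈ gr a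
  map_add : ∀ (x : Fin (p + 2) → V) (i : Fin (p + 2)) (u v : V),
    nbr (Function.update x i (u + v)) = nbr (Function.update x i u) + nbr (Function.update x i v)
  map_smul : ∀ (x : Fin (p + 2) → V) (i : Fin (p + 2)) (c : K) (u : V),
    nbr (Function.update x i (c • u)) = c • nbr (Function.update x i u)
  even : ∀ (d : Fin (p + 2) → ZMod 2) (x : Fin (p + 2) → V), (∀ i, x i ∈ gr (d i)) →
    nbr x ∈ gr (∑ i, d i)
  nambu : ∀ (dx : Fin (p + 1) → ZMod 2) (x : Fin (p + 1) → V)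
      (dy : Fin (p + 2) → ZMod 2) (y : Fin (p + 2) → V),
      (∀ i, x i ∈ gr (dx i)) → (∀ i, y i ∈ gr (dy i)) →
    nbr (Fin.snoc (fun i => β (x i)) (nbr y)) =
      ∑ i : Fin (p + 2), sgn K ((∑ k, dx k) * partSum dy i) •
        nbr (Function.update (fun j => β (y j)) i (nbr (Fin.snoc x (y i))))

/-- A multiplicative `n`-ary Hom-Nambu superalgebra (`n = p+2`). -/
structure IsMultNaryHomNambuSuper {p : ℕ} (gr : ZMod 2 → Submodule K V)
    (nbr : (Fin (p + 2) → V) → V) (β : Module.End K V)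
    extends IsNaryHomNambuSuper gr nbr β : Prop where
  mult : ∀ x : Fin (p + 2) → V, β (nbr x) = nbr fun i => β (x i)

/-- The `n`-ary bracket (`n = p+2`) induced by a binary Hom-Lie superalgebra bracket:
`[x₁,…,xₙ]ₙ = [[…[[x₁,x₂],α(x₃)],…],α^{n-2}(xₙ)]`. -/
def nBr (br : V →ₗ[K] V →ₗ[K] V) (α : Module.End K V) : (p : ℕ) → (Fin (p + 2) → V) → V
  | 0, x => br (x 0) (x 1)
  | p + 1, x => br (nBr br α p (Fin.init x)) ((α ^ (p + 1)) (x (Fin.last (p + 2))))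

/-- A homogeneous `α^k`-derivation of degree `dD` of a binary Hom-superalgebra. -/
def IsAlphaKDeriv2 (gr : ZMod 2 → Submodule K V) (br : V →ₗ[K] V →ₗ[K] V)
    (α : Module.End K V) (k : ℕ) (dD : ZMod 2) (D : Module.End K V) : Prop :=
  D * α = α * D ∧ (∀ (a : ZMod 2) (x : V), x ∈ gr a → D x ∈ gr (a + dD)) ∧
  ∀ (a b : ZMod 2) (x y : V), x ∈ gr a → y ∈ gr b →
    D (br x y) = br (D x) ((α ^ k) y) + sgn K (dD * a) • br ((α ^ k) x) (D y)

/-- A homogeneous `α^k`-derivation of degree `dD` of an `n`-ary Hom-superalgebra (`n = p+2`). -/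
def IsNaryAlphaKDeriv {p : ℕ} (gr : ZMod 2 → Submodule K V)
    (nbr : (Fin (p + 2) → V) → V) (α : Module.End K V) (k : ℕ) (dD : ZMod 2)
    (D : Module.End K V) : Prop :=
  D * α = α * D ∧ (∀ (a : ZMod 2) (x : V), x ∈ gr a → D x ∈ gr (a + dD)) ∧
  ∀ (dy : Fin (p + 2) → ZMod 2) (y : Fin (p + 2) → V), (∀ i, y i ∈ gr (dy i)) →
    D (nbr y) = ∑ i : Fin (p + 2), sgn K (dD * partSum dy i) •
      nbr (Function.update (fun j => (α ^ k) (y j)) i (D (y i)))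

/-- Rota-Baxter operator of weight `0` on a binary Hom-superalgebra. -/
def IsRotaBaxter2 (gr : ZMod 2 → Submodule K V) (br : V →ₗ[K] V →ₗ[K] V)
    (α : Module.End K V) (R : Module.End K V) : Prop :=
  (∀ (a : ZMod 2) (x : V), x ∈ gr a → R x ∈ gr a) ∧ R * α = α * R ∧
  ∀ x y : V, br (R x) (R y) = R (br (R x) y + br x (R y))

/-- The `3`-supercommutator of a ternary product, on homogeneous elements of degrees `a,b,c`. -/
def cbr (T : V → V → V → V) (a b c : ZMod 2) (x y z : V) : V :=
  T x y z + sgn K (a * (b + c)) • T y z x + sgn K (c * (a + b)) • T z x y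

/-- A `3`-Hom-Lie superalgebra structure. -/
structure Is3HomLieSuper (gr : ZMod 2 → Submodule K V)
    (br : V →ₗ[K] V →ₗ[K] V →ₗ[K] V) (α : Module.End K V) : Prop where
  internal : DirectSum.IsInternal gr
  alpha_even : ∀ (a : ZMod 2) (x : V), x ∈ gr a → α x ∈ gr a
  even : ∀ (a b c : ZMod 2) (x y z : V), x ∈ gr a → y ∈ gr b → z ∈ gr c →
    br x y z ∈ gr (a + b + c)
  skew12 : ∀ (a b c : ZMod 2) (x y z : V), x ∈ gr a → y ∈ gr b → z ∈ gr c →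
    br x y z = - sgn K (a * b) • br y x z
  skew23 : ∀ (a b c : ZMod 2) (x y z : V), x ∈ gr a → y ∈ gr b → z ∈ gr c →
    br x y z = - sgn K (b * c) • br x z y
  nambu : ∀ (a₁ a₂ b₁ b₂ b₃ : ZMod 2) (x₁ x₂ y₁ y₂ y₃ : V),
    x₁ ∈ gr a₁ → x₂ ∈ gr a₂ → y₁ ∈ gr b₁ → y₂ ∈ gr b₂ → y₃ ∈ gr b₃ →
    br (α x₁) (α x₂) (br y₁ y₂ y₃) =
      br (br x₁ x₂ y₁) (α y₂) (α y₃)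
      + sgn K ((a₁ + a₂) * b₁) • br (α y₁) (br x₁ x₂ y₂) (α y₃)
      + sgn K ((a₁ + a₂) * (b₁ + b₂)) • br (α y₁) (α y₂) (br x₁ x₂ y₃)

/-- A `3`-Hom-pre-Lie superalgebra structure. -/
structure Is3HomPreLieSuper (gr : ZMod 2 → Submodule K V)
    (T : V →ₗ[K] V →ₗ[K] V →ₗ[K] V) (α : Module.End K V) : Prop where
  internal : DirectSum.IsInternal gr
  alpha_even : ∀ (a : ZMod 2) (x : V), x ∈ gr a → α x ∈ gr a
  even : ∀ (a b c : ZMod 2) (x y z : V), x ∈ gr a → y ∈ gr b → z ∈ gr c →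
    T x y z ∈ gr (a + b + c)
  skew12 : ∀ (a b c : ZMod 2) (x y z : V), x ∈ gr a → y ∈ gr b → z ∈ gr c →
    T x y z = - sgn K (a * b) • T y x z
  ax2 : ∀ (a₁ a₂ a₃ a₄ a₅ : ZMod 2) (x₁ x₂ x₃ x₄ x₅ : V),
    x₁ ∈ gr a₁ → x₂ ∈ gr a₂ → x₃ ∈ gr a₃ → x₄ ∈ gr a₄ → x₅ ∈ gr a₅ →
    T (α x₁) (α x₂) (T x₃ x₄ x₅) =
      T (cbr (K := K) (fun u v w => T u v w) a₁ a₂ a₃ x₁ x₂ x₃) (α x₄) (α x₅)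
      + sgn K (a₃ * (a₁ + a₂)) •
          T (α x₃) (cbr (K := K) (fun u v w => T u v w) a₁ a₂ a₄ x₁ x₂ x₄) (α x₅)
      + sgn K ((a₁ + a₂) * (a₃ + a₄)) • T (α x₃) (α x₄) (T x₁ x₂ x₅)
  ax3 : ∀ (a₁ a₂ a₃ a₄ a₅ : ZMod 2) (x₁ x₂ x₃ x₄ x₅ : V),
    x₁ ∈ gr a₁ → x₂ ∈ gr a₂ → x₃ ∈ gr a₃ → x₄ ∈ gr a₄ → x₅ ∈ gr a₅ →
    T (cbr (K := K) (fun u v w => T u v w) a₁ a₂ a₃ x₁ x₂ x₃) (α x₄) (α x₅) =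
      T (α x₁) (α x₂) (T x₃ x₄ x₅)
      + sgn K (a₁ * (a₂ + a₃)) • T (α x₂) (α x₃) (T x₁ x₄ x₅)
      + sgn K (a₃ * (a₁ + a₂)) • T (α x₃) (α x₁) (T x₂ x₄ x₅)

/-- Rota-Baxter operator of weight `0` on a `3`-Hom-Lie superalgebra. -/
def IsRotaBaxter3 (gr : ZMod 2 → Submodule K V)
    (br : V →ₗ[K] V →ₗ[K] V →ₗ[K] V) (α : Module.End K V) (R : Module.End K V) : Prop :=
  (∀ (a : ZMod 2) (x : V), x ∈ gr a → R x ∈ gr a) ∧ R * α = α * R ∧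
  ∀ x y z : V, br (R x) (R y) (R z) =
    R (br (R x) (R y) z + br (R x) y (R z) + br x (R y) (R z))

theorem sgn_add (a b : ZMod 2) : sgn K (a + b) = sgn K a * sgn K b := by
  have h : ((a + b).val : ℕ) = (a.val + b.val) % 2 := ZMod.val_add a b
  rw [sgn, h, ← neg_one_pow_eq_pow_mod_two, pow_add, sgn, sgn]

theorem skip2_ne_left {m : ℕ} {p q : Fin (m + 3)} (l : Fin (m + 1)) :
    skip2 p q l ≠ p := by
  intro h
  have := congrArg Fin.val h
  unfold skip2 at this
  split_ifs at this <;> simp at this <;> omega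

theorem skip2_ne_right {m : ℕ} {p q : Fin (m + 3)} (hpq : p < q) (l : Fin (m + 1)) :
    skip2 p q l ≠ q := by
  intro h
  have := congrArg Fin.val h
  have hpq' : (p : ℕ) < q := hpq
  unfold skip2 at this
  split_ifs at this <;> simp at this <;> omega

theorem skip2_strictMono {m : ℕ} (p q : Fin (m + 3)) : StrictMono (skip2 p q) := by
  intro a b hab
  have hab' : (a : ℕ) < b := hab
  rw [Fin.lt_def]
  unfold skip2
  split_ifs <;> simp <;> omega

theorem exists_skip2_eq {m : ℕ} {p q : Fin (m + 3)} (hpq : p < q) {i : Fin (m + 3)}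
    (hp : i ≠ p) (hq : i ≠ q) : ∃ l, skip2 p q l = i := by
  have hpq' : (p : ℕ) < q := hpq
  have hp' : (i : ℕ) ≠ p := fun h => hp (Fin.ext h)
  have hq' : (i : ℕ) ≠ q := fun h => hq (Fin.ext h)
  have := i.isLt
  have := q.isLt
  by_cases h1 : (i : ℕ) < p
  · refine ⟨⟨i, by omega⟩, Fin.ext ?_⟩
    simp [skip2, h1]
  · by_cases h2 : (i : ℕ) < q
    · refine ⟨⟨(i : ℕ) - 1, by omega⟩, Fin.ext ?_⟩
      rw [skip2, dif_neg (show ¬(i : ℕ) - 1 < p by omega),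
        dif_pos (show (i : ℕ) - 1 + 1 < q by omega)]
      change (i : ℕ) - 1 + 1 = i
      omega
    · refine ⟨⟨(i : ℕ) - 2, by omega⟩, Fin.ext ?_⟩
      rw [skip2, dif_neg (show ¬(i : ℕ) - 2 < p by omega),
        dif_neg (show ¬(i : ℕ) - 2 + 1 < q by omega)]
      change (i : ℕ) - 2 + 2 = i
      omega

/-- Splitting a sum over all positions into the two omitted positions and the remaining ones. -/
theorem sum_eq_add_sum_skip2 {M : Type*} [AddCommMonoid M] {m : ℕ} {p q : Fin (m + 3)}
    (hpq : p < q) (f : Fin (m + 3) → M) :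
    ∑ i, f i = f p + f q + ∑ l, f (skip2 p q l) := by
  have hu : (Finset.univ : Finset (Fin (m + 3))) =
      insert p (insert q (Finset.univ.image (skip2 p q))) := by
    ext i
    simp only [Finset.mem_univ, Finset.mem_insert, Finset.mem_image, true_and, true_iff]
    by_cases hp : i = p
    · exact Or.inl hp
    by_cases hq : i = q
    · exact Or.inr (Or.inl hq)
    exact Or.inr (Or.inr (exists_skip2_eq hpq hp hq))
  rw [hu, Finset.sum_insert, Finset.sum_insert, Finset.sum_image, add_assoc]
  · exact fun a _ b _ h => (skip2_strictMono p q).injective h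
  · simpa using fun l => skip2_ne_right hpq l
  · simpa [hpq.ne] using fun l => skip2_ne_left l

theorem update_add_eq_add_single {n : ℕ} (d : Fin n → ZMod 2) (i : Fin n) (e : ZMod 2) :
    Function.update d i (d i + e) = d + Pi.single i e := by
  ext j
  by_cases h : j = i
  · subst h; simp
  · simp [h]

theorem gamma_update {n : ℕ} (d : Fin n → ZMod 2) (i p q : Fin n) (e : ZMod 2) :
    gamma (Function.update d i (d i + e)) p q =
      (d p + (if p = i then e else 0) + (d q + if q = i then e else 0)) *
        (sumAfter d q + if q < i then e else 0) +
      (d p + if p = i then e else 0) *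
        (sumBetween d p q + if p < i ∧ i < q then e else 0) := by
  rw [update_add_eq_add_single]
  simp [gamma, sumAfter, sumBetween, Finset.sum_add_distrib, Pi.single_apply]

theorem sum_skip2_eq_left {m : ℕ} {p q : Fin (m + 3)} (hpq : p < q) (d : Fin (m + 3) → ZMod 2) :
    partSum d p + sumBetween d p q + sumAfter d q = ∑ l, d (skip2 p q l) := by
  have h : ∀ l, (if skip2 p q l < p then d (skip2 p q l) else 0) +
      (if p < skip2 p q l ∧ skip2 p q l < q then d (skip2 p q l) else 0) +
      (if q < skip2 p q l then d (skip2 p q l) else 0) = d (skip2 p q l) := by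
    intro l
    have h1 := skip2_ne_left (p := p) (q := q) l
    have h2 := skip2_ne_right hpq l
    rcases lt_or_gt_of_ne h1 with h1 | h1 <;> rcases lt_or_gt_of_ne h2 with h2 | h2
    · simp [h1, h1.asymm, h2.asymm]
    · exact absurd (h1.trans hpq) h2.asymm
    · simp [h1, h2, h1.asymm, h2.asymm]
    · simp [h1, h2, h1.asymm, h2.asymm]
  simp only [partSum, sumAfter, sumBetween, Finset.sum_filter]
  rw [sum_eq_add_sum_skip2 hpq, sum_eq_add_sum_skip2 hpq, sum_eq_add_sum_skip2 hpq,
    ← Finset.sum_congr rfl fun l _ => h l]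
  simp [Finset.sum_add_distrib, hpq.asymm]

theorem partSum_right {m : ℕ} {p q : Fin (m + 3)} (hpq : p < q) (d : Fin (m + 3) → ZMod 2) :
    partSum d q = partSum d p + d p + sumBetween d p q := by
  have h : ∀ i, (if i < q then d i else 0) = (if i < p then d i else 0) +
      (if i = p then d i else 0) + (if p < i ∧ i < q then d i else 0) := by
    intro i
    rcases lt_trichotomy i p with h | h | h
    · simp [h, h.trans hpq, h.ne, h.asymm]
    · simp [h, hpq]
    · simp [h, h.ne', h.asymm]
  simp only [partSum, sumBetween, Finset.sum_filter, h, Finset.sum_add_distrib]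
  simp

theorem partSum_skip2 {m : ℕ} {p q : Fin (m + 3)} (hpq : p < q) (d : Fin (m + 3) → ZMod 2)
    (l : Fin (m + 1)) :
    partSum d (skip2 p q l) = (if p < skip2 p q l then d p else 0) +
      (if q < skip2 p q l then d q else 0) + partSum (d ∘ skip2 p q) l := by
  simp only [partSum, Finset.sum_filter]
  rw [sum_eq_add_sum_skip2 hpq]
  simp [(skip2_strictMono p q).lt_iff_lt]

/-- The sign identity for a derivation of degree `e` acting on the first omitted position. -/
theorem sign_left {m : ℕ} {p q : Fin (m + 3)} (hpq : p < q) (d : Fin (m + 3) → ZMod 2)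
    (e : ZMod 2) (h0 : ∑ l, d (skip2 p q l) = 0) :
    e * partSum d p + gamma (Function.update d p (d p + e)) p q = gamma d p q := by
  rw [← sum_skip2_eq_left hpq d] at h0
  rw [gamma_update, gamma]
  simp only [if_true, hpq.ne', if_false, hpq.asymm, lt_irrefl, false_and]
  linear_combination e * h0

/-- The sign identity for a derivation of degree `e` acting on the second omitted position. -/
theorem sign_right {m : ℕ} {p q : Fin (m + 3)} (hpq : p < q) (d : Fin (m + 3) → ZMod 2)
    (e : ZMod 2) (h0 : ∑ l, d (skip2 p q l) = 0) :
    e * partSum d q + gamma (Function.update d q (d q + e)) p q = gamma d p q + e * d p := by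
  rw [← sum_skip2_eq_left hpq d] at h0
  rw [gamma_update, gamma, partSum_right hpq]
  simp only [if_true, hpq.ne, if_false, lt_irrefl, and_false]
  linear_combination e * h0

/-- The sign identity for a derivation of degree `e` acting on one of the kept positions. -/
theorem sign_skip2 {m : ℕ} {p q : Fin (m + 3)} (hpq : p < q) (d : Fin (m + 3) → ZMod 2)
    (e : ZMod 2) (l : Fin (m + 1)) :
    e * partSum d (skip2 p q l) +
        gamma (Function.update d (skip2 p q l) (d (skip2 p q l) + e)) p q =
      gamma d p q + e * partSum (d ∘ skip2 p q) l := by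
  have h1 := skip2_ne_left (p := p) (q := q) l
  have h2 := skip2_ne_right hpq l
  rw [gamma_update, gamma, partSum_skip2 hpq]
  have hp : e * d p + e * d p = 0 := CharTwo.add_self_eq_zero _
  have hq : e * d q + e * d q = 0 := CharTwo.add_self_eq_zero _
  simp only [h1.symm, h2.symm, if_false, add_zero]
  rcases lt_or_gt_of_ne h1 with h1 | h1 <;> rcases lt_or_gt_of_ne h2 with h2 | h2
  · simp only [h1.asymm, h2.asymm, if_false, false_and]
    ring
  · exact absurd (h1.trans hpq) h2.asymm
  · simp only [h1, h2, h2.asymm, if_false, if_true, and_self]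
    linear_combination hp
  · simp only [h1, h2, h2.asymm, if_false, if_true, and_false]
    linear_combination hp + hq

theorem pow_apply_mem {gr : ZMod 2 → Submodule K V} {α : Module.End K V}
    (hα : ∀ (a : ZMod 2) (x : V), x ∈ gr a → α x ∈ gr a) (k : ℕ) {a : ZMod 2} {x : V}
    (hx : x ∈ gr a) : (α ^ k) x ∈ gr a := by
  induction k with
  | zero => simpa using hx
  | succ k ih => rw [pow_succ', Module.End.mul_apply]; exact hα _ _ ih

theorem update_mem {gr : ZMod 2 → Submodule K V} {p : ℕ} {d : Fin p → ZMod 2} {x : Fin p → V}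
    (hx : ∀ i, x i ∈ gr (d i)) {j : Fin p} {v : V} (hv : v ∈ gr (d j)) (i : Fin p) :
    Function.update x j v i ∈ gr (d i) := by
  by_cases h : i = j
  · subst h; simpa using hv
  · simpa [h] using hx i

/-- A super-skew-symmetric form invariant under `α` in the first slot is invariant under `α`
in every slot. -/
theorem FormSuperSkew.apply_update {m : ℕ} {gr : ZMod 2 → Submodule K V} {α : Module.End K V}
    (hα : ∀ (a : ZMod 2) (x : V), x ∈ gr a → α x ∈ gr a)
    {φ : MultilinearMap K (fun _ : Fin (m + 1) => V) K}
    (hs : FormSuperSkew gr φ) (hc : PhiCond2 φ α) (j : Fin (m + 1)) :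
    ∀ (d : Fin (m + 1) → ZMod 2) (x : Fin (m + 1) → V), (∀ i, x i ∈ gr (d i)) →
      φ (Function.update x j (α (x j))) = φ x := by
  obtain ⟨j, hj⟩ := j
  induction j with
  | zero => exact fun _ x _ => hc x
  | succ j ih =>
    intro d x hx
    set a : Fin (m + 1) := ⟨j, by omega⟩
    set b : Fin (m + 1) := ⟨j + 1, hj⟩
    have hab : (b : ℕ) = a + 1 := rfl
    rw [hs d _ (update_mem hx (hα _ _ (hx b))) a b hab, hs d x hx a b hab]
    have hcomp : Function.update x b (α (x b)) ∘ Equiv.swap a b =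
        Function.update (x ∘ Equiv.swap a b) a (α ((x ∘ Equiv.swap a b) a)) := by
      rw [Function.update_comp_equiv]
      simp
    rw [hcomp, ih (by omega) (d ∘ Equiv.swap a b) (x ∘ Equiv.swap a b) fun i => hx _]

theorem FormSuperSkew.apply_update_pow {m : ℕ} {gr : ZMod 2 → Submodule K V}
    {α : Module.End K V} (hα : ∀ (a : ZMod 2) (x : V), x ∈ gr a → α x ∈ gr a)
    {φ : MultilinearMap K (fun _ : Fin (m + 1) => V) K}
    (hs : FormSuperSkew gr φ) (hc : PhiCond2 φ α) (k : ℕ) (j : Fin (m + 1))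
    {d : Fin (m + 1) → ZMod 2} {x : Fin (m + 1) → V} (hx : ∀ i, x i ∈ gr (d i)) :
    φ (Function.update x j ((α ^ k) (x j))) = φ x := by
  induction k with
  | zero => simp
  | succ k ih =>
    have h := hs.apply_update hα hc j d _ (update_mem hx (pow_apply_mem hα k (hx j)))
    rw [Function.update_self, Function.update_idem, ih] at h
    rw [pow_succ', Module.End.mul_apply, h]

/-- Invariance under `α ^ k` applied in any set of slots. -/
theorem FormSuperSkew.apply_piecewise_pow {m : ℕ} {gr : ZMod 2 → Submodule K V}
    {α : Module.End K V} (hα : ∀ (a : ZMod 2) (x : V), x ∈ gr a → α x ∈ gr a)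
    {φ : MultilinearMap K (fun _ : Fin (m + 1) => V) K}
    (hs : FormSuperSkew gr φ) (hc : PhiCond2 φ α) (k : ℕ) (s : Finset (Fin (m + 1)))
    {d : Fin (m + 1) → ZMod 2} {x : Fin (m + 1) → V} (hx : ∀ i, x i ∈ gr (d i)) :
    φ (s.piecewise (fun i => (α ^ k) (x i)) x) = φ x := by
  induction s using Finset.induction_on with
  | empty => simp
  | insert j s hj ih =>
    have hmem : ∀ i, s.piecewise (fun i => (α ^ k) (x i)) x i ∈ gr (d i) := by
      intro i
      by_cases h : i ∈ s
      · simpa [h] using pow_apply_mem hα k (hx i)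
      · simpa [h] using hx i
    have h := hs.apply_update_pow hα hc k j hmem
    rw [Finset.piecewise_eq_of_notMem s _ _ hj] at h
    rw [Finset.piecewise_insert, h, ih]

theorem stmt3 (m k : ℕ) (gr : ZMod 2 → Submodule K V) (br : V →ₗ[K] V →ₗ[K] V)
    (α : Module.End K V) (hg : IsHomLieSuper gr br α)
    (hmult : ∀ u v : V, α (br u v) = br (α u) (α v))
    (φ : MultilinearMap K (fun _ : Fin (m + 1) => V) K)
    (hφe : FormEven gr φ) (hφs : FormSuperSkew gr φ)
    (hc1 : PhiCond1 gr br φ) (hc2 : PhiCond2 φ α)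
    (dD : ZMod 2) (D : Module.End K V)
    (hDα : D * α = α * D)
    (hDgr : ∀ (a : ZMod 2) (x : V), x ∈ gr a → D x ∈ gr (a + dD))
    (hDder : ∀ (a b : ZMod 2) (x y : V), x ∈ gr a → y ∈ gr b →
      D (br x y) = br (D x) ((α ^ k) y) + sgn K (dD * a) • br ((α ^ k) x) (D y))
    (hφD : ∀ (d : Fin (m + 1) → ZMod 2) (x : Fin (m + 1) → V), (∀ i, x i ∈ gr (d i)) →
      ∑ i : Fin (m + 1), sgn K (dD * partSum d i) * φ (Function.update x i (D (x i))) = 0) :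
    ∀ (d : Fin (m + 3) → ZMod 2) (x : Fin (m + 3) → V), (∀ i, x i ∈ gr (d i)) →
      D (phiBr br φ d x) = ∑ i : Fin (m + 3), sgn K (dD * partSum d i) •
        phiBr br φ (Function.update d i (d i + dD))
          (Function.update (fun j => (α ^ k) (x j)) i (D (x i))) := by
  intro d x hx
  have hα := hg.alpha_even
  simp only [phiBr, map_sum, Finset.smul_sum]
  rw [Finset.sum_comm]
  refine Finset.sum_congr rfl fun ⟨p, q⟩ hpq => ?_
  replace hpq : p < q := by simpa using hpq
  dsimp only
  rw [sum_eq_add_sum_skip2 hpq]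
  have hxs : ∀ l, (x ∘ skip2 p q) l ∈ gr ((d ∘ skip2 p q) l) := fun l => hx _
  have hφα : φ ((fun j => (α ^ k) (x j)) ∘ skip2 p q) = φ (x ∘ skip2 p q) := by
    rw [← hφs.apply_piecewise_pow hα hc2 k Finset.univ hxs, Finset.piecewise_univ]
    rfl
  have hkept : ∀ l, φ (Function.update (fun j => (α ^ k) (x j)) (skip2 p q l)
      (D (x (skip2 p q l))) ∘ skip2 p q) =
      φ (Function.update (x ∘ skip2 p q) l (D ((x ∘ skip2 p q) l))) := by
    intro l
    have hmem : ∀ i, Function.update (x ∘ skip2 p q) l (D ((x ∘ skip2 p q) l)) i ∈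
        gr (Function.update (d ∘ skip2 p q) l ((d ∘ skip2 p q) l + dD) i) := by
      intro i
      by_cases h : i = l
      · subst h; simpa using hDgr _ _ (hxs i)
      · simpa [h] using hx _
    rw [← hφs.apply_piecewise_pow hα hc2 k (Finset.univ.erase l) hmem]
    congr 1
    ext i
    by_cases h : i = l
    · subst h; simp
    · simp [h, (skip2_strictMono p q).injective.ne h]
  have hzero : ∑ l, sgn K (dD * partSum d (skip2 p q l)) •
      (((-1 : K) ^ ((p : ℕ) + (q : ℕ) + 1) *
        sgn K (gamma (Function.update d (skip2 p q l) (d (skip2 p q l) + dD)) p q) *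
        φ (Function.update (fun j => (α ^ k) (x j)) (skip2 p q l)
          (D (x (skip2 p q l))) ∘ skip2 p q)) •
        br (Function.update (fun j => (α ^ k) (x j)) (skip2 p q l) (D (x (skip2 p q l))) p)
          (Function.update (fun j => (α ^ k) (x j)) (skip2 p q l) (D (x (skip2 p q l))) q)) =
      0 := by
    have hterm := hφD (d ∘ skip2 p q) (x ∘ skip2 p q) hxs
    calc _ = ∑ l, ((-1 : K) ^ ((p : ℕ) + (q : ℕ) + 1) * sgn K (gamma d p q) *
          (sgn K (dD * partSum (d ∘ skip2 p q) l) *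
            φ (Function.update (x ∘ skip2 p q) l (D ((x ∘ skip2 p q) l))))) •
          br ((α ^ k) (x p)) ((α ^ k) (x q)) := by
          refine Finset.sum_congr rfl fun l _ => ?_
          have hsign := congrArg (sgn K) (sign_skip2 hpq d dD l)
          rw [sgn_add, sgn_add] at hsign
          rw [hkept, Function.update_of_ne (skip2_ne_left l).symm,
            Function.update_of_ne (skip2_ne_right hpq l).symm, smul_smul]
          congr 1
          linear_combination (-1 : K) ^ ((p : ℕ) + (q : ℕ) + 1) *
            φ (Function.update (x ∘ skip2 p q) l (D ((x ∘ skip2 p q) l))) * hsign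
      _ = 0 := by rw [← Finset.sum_smul, ← Finset.mul_sum, hterm, mul_zero, zero_smul]
  have hcomp : ∀ i v, (∀ l, skip2 p q l ≠ i) →
      Function.update (fun j => (α ^ k) (x j)) i v ∘ skip2 p q =
        (fun j => (α ^ k) (x j)) ∘ skip2 p q := by
    intro i v h
    ext l
    simp [h l]
  rw [hzero, add_zero, hcomp p _ skip2_ne_left, hcomp q _ (skip2_ne_right hpq), hφα, map_smul,
    hDder _ _ _ _ (hx p) (hx q)]
  simp only [Function.update_self, Function.update_of_ne hpq.ne, Function.update_of_ne hpq.ne']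
  by_cases h0 : ∑ l, (d ∘ skip2 p q) l = 0
  · have hl := congrArg (sgn K) (sign_left hpq d dD h0)
    have hr := congrArg (sgn K) (sign_right hpq d dD h0)
    rw [sgn_add] at hl
    rw [sgn_add, sgn_add] at hr
    rw [smul_add, smul_smul, smul_smul, smul_smul]
    congr 2
    · linear_combination -(-1 : K) ^ ((p : ℕ) + (q : ℕ) + 1) * φ (x ∘ skip2 p q) * hl
    · linear_combination -(-1 : K) ^ ((p : ℕ) + (q : ℕ) + 1) * φ (x ∘ skip2 p q) * hr
  · simp [hφe _ _ hxs h0]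

end NHomSuper
end

section
/- Let (g,[·,·],α) be a multiplicative Hom-Lie superalgebra over a field K of characteristic zero and n ≥ 2. Define the n-linear bracket [x₁,…,xₙ]ₙ = [[…[[x₁,x₂],α(x₃)],α²(x₄)],…,α^{n−2}(xₙ)]. Then gₙ = (g, [·,…,·]ₙ, α^{n−1}) is a multiplicative n-ary Hom-Nambu superalgebra: the bracket is even, α^{n−1}([x₁,…,xₙ]ₙ) = [α^{n−1}(x₁),…,α^{n−1}(xₙ)]ₙ, and [α^{n−1}(x₁),…,α^{n−1}(x_{n−1}), [y₁,…,yₙ]ₙ]ₙ = Σ_{i=1}^{n} (−1)^{|X||Y|^{i−1}} [α^{n−1}(y₁),…,α^{n−1}(y_{i−1}),[x₁,…,x_{n−1},yᵢ]ₙ,α^{n−1}(y_{i+1}),…,α^{n−1}(yₙ)]ₙ for all homogeneous arguments, where |X| = Σ_k |xₖ| and |Y|^{i−1} = Σ_{k<i} |yₖ|. -/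
namespace NHomSuper

variable {K : Type*} [Field K] [CharZero K]
variable {V : Type*} [AddCommGroup V] [Module K V]

section HomLieSuperalgebra

variable {F : Type*} [Field F] {W : Type*} [AddCommGroup W] [Module F W]
variable {gr : ZMod 2 → Submodule F W} {br : W →ₗ[F] W →ₗ[F] W} {α : Module.End F W}

theorem IsHomLieSuper.pow_alpha_even (hg : IsHomLieSuper gr br α) (k : ℕ) {a : ZMod 2} {x : W}
    (hx : x ∈ gr a) : (α ^ k) x ∈ gr a := by
  induction k with
  | zero => simpa using hx
  | succ k ih =>
    rw [pow_succ', Module.End.mul_apply]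
    exact hg.alpha_even a _ ih

/-- The super Hom-Jacobi identity in derivation form. -/
theorem IsHomLieSuper.leibniz (hg : IsHomLieSuper gr br α) {a b c : ZMod 2} {x y z : W}
    (hx : x ∈ gr a) (hy : y ∈ gr b) (hz : z ∈ gr c) :
    br (α x) (br y z) = br (br x y) (α z) + sgn F (a * b) • br (α y) (br x z) := by
  have hj := hg.jacobi a b c x y z hx hy hz
  rw [hg.skew c a z x hz hx,
    hg.skew c (a + b) (α z) (br x y) (hg.alpha_even c z hz) (hg.br_even a b x y hx hy),
    map_smul] at hj
  have h11 : (1 : ZMod 2) + 1 = 0 := by decide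
  have hv : (1 : ZMod 2).val = 1 := rfl
  have h01 : ∀ t : ZMod 2, t = 0 ∨ t = 1 := by decide
  clear hx hy hz
  rcases h01 a with rfl | rfl <;> rcases h01 b with rfl | rfl <;> rcases h01 c with rfl | rfl <;>
    simp [sgn, hv, h11] at hj ⊢ <;> grind

theorem pow_apply_br (hmult : ∀ u v : W, α (br u v) = br (α u) (α v)) (k : ℕ) (u v : W) :
    (α ^ k) (br u v) = br ((α ^ k) u) ((α ^ k) v) := by
  induction k with
  | zero => simp
  | succ k ih => simp only [pow_succ', Module.End.mul_apply, ih, hmult]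

theorem pow_apply_pow_apply (k l : ℕ) (v : W) : (α ^ k) ((α ^ l) v) = (α ^ l) ((α ^ k) v) := by
  rw [← Module.End.mul_apply, ← Module.End.mul_apply, pow_mul_comm]

theorem pow_apply_nBr (hmult : ∀ u v : W, α (br u v) = br (α u) (α v)) (k p : ℕ)
    (x : Fin (p + 2) → W) : (α ^ k) (nBr br α p x) = nBr br α p fun i => (α ^ k) (x i) := by
  induction p with
  | zero => exact pow_apply_br hmult k _ _
  | succ p ih =>
    simp only [nBr]
    rw [pow_apply_br hmult, ih, pow_apply_pow_apply]
    rfl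

theorem nBr_update_add (p : ℕ) (x : Fin (p + 2) → W) (i : Fin (p + 2)) (u v : W) :
    nBr br α p (Function.update x i (u + v)) =
      nBr br α p (Function.update x i u) + nBr br α p (Function.update x i v) := by
  induction p with
  | zero => fin_cases i <;> simp [nBr]
  | succ p ih =>
    induction i using Fin.lastCases with
    | last => simp [nBr, Fin.init_update_last]
    | cast i =>
      simp [nBr, Fin.init_update_castSucc, ih, Function.update_of_ne (Fin.castSucc_ne_last i).symm]

theorem nBr_update_smul (p : ℕ) (x : Fin (p + 2) → W) (i : Fin (p + 2)) (c : F) (u : W) :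
    nBr br α p (Function.update x i (c • u)) = c • nBr br α p (Function.update x i u) := by
  induction p with
  | zero => fin_cases i <;> simp [nBr]
  | succ p ih =>
    induction i using Fin.lastCases with
    | last => simp [nBr, Fin.init_update_last]
    | cast i =>
      simp [nBr, Fin.init_update_castSucc, ih, Function.update_of_ne (Fin.castSucc_ne_last i).symm]

theorem IsHomLieSuper.nBr_even (hg : IsHomLieSuper gr br α) (p : ℕ) (d : Fin (p + 2) → ZMod 2)
    (x : Fin (p + 2) → W) (hx : ∀ i, x i ∈ gr (d i)) : nBr br α p x ∈ gr (∑ i, d i) := by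
  induction p with
  | zero =>
    rw [Fin.sum_univ_two]
    exact hg.br_even _ _ _ _ (hx 0) (hx 1)
  | succ p ih =>
    rw [Fin.sum_univ_castSucc]
    exact hg.br_even _ _ _ _ (ih _ _ fun i => hx i.castSucc) (hg.pow_alpha_even _ (hx _))

theorem partSum_last {n : ℕ} (d : Fin (n + 1) → ZMod 2) :
    partSum d (Fin.last n) = ∑ i, Fin.init d i := by
  simp [partSum, Finset.sum_filter, Fin.sum_univ_castSucc, Fin.init, Fin.castSucc_lt_last]

theorem partSum_castSucc {n : ℕ} (d : Fin (n + 1) → ZMod 2) (i : Fin n) :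
    partSum d i.castSucc = partSum (Fin.init d) i := by
  simp [partSum, Finset.sum_filter, Fin.sum_univ_castSucc, Fin.init, (Fin.castSucc_lt_last i).not_gt]

/-- Left multiplication by a homogeneous element acts on `nBr` as a twisted derivation. -/
theorem IsHomLieSuper.br_nBr (hg : IsHomLieSuper gr br α)
    (hmult : ∀ u v : W, α (br u v) = br (α u) (α v)) (p : ℕ) {a : ZMod 2} {u : W} (hu : u ∈ gr a)
    (d : Fin (p + 2) → ZMod 2) (w : Fin (p + 2) → W) (hw : ∀ i, w i ∈ gr (d i)) :
    br ((α ^ (p + 1)) u) (nBr br α p w) =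
      ∑ i, sgn F (a * partSum d i) •
        nBr br α p (Function.update (fun j => α (w j)) i (br u (w i))) := by
  induction p with
  | zero =>
    have h0 : partSum d 0 = 0 := by simp [partSum]
    have h1 : partSum d 1 = d 0 := by simp [partSum, Finset.sum_filter]
    simp [Fin.sum_univ_two, nBr, h0, h1, hg.leibniz hu (hw 0) (hw 1), sgn]
  | succ p ih =>
    have hi : ∀ i, Fin.init w i ∈ gr (Fin.init d i) := fun i => hw i.castSucc
    have hα : α (nBr br α p (Fin.init w)) = nBr br α p fun i => α (Fin.init w i) := by
      simpa only [pow_one] using pow_apply_nBr hmult 1 p (Fin.init w)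
    have hl : ∀ v, α ((α ^ (p + 1)) v) = (α ^ (p + 1)) (α v) := fun v => by
      simpa only [pow_one] using pow_apply_pow_apply (α := α) 1 (p + 1) v
    rw [Fin.sum_univ_castSucc]
    simp only [nBr, Fin.init_update_castSucc, Fin.init_update_last, Function.update_self,
      Function.update_of_ne (Fin.castSucc_ne_last _).symm, partSum_last, partSum_castSucc]
    rw [pow_succ' α (p + 1), Module.End.mul_apply,
      hg.leibniz (hg.pow_alpha_even _ hu) (hg.nBr_even p _ _ hi) (hg.pow_alpha_even _ (hw _)),
      ih _ _ hi, ← pow_apply_br hmult, hα, map_sum,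
      LinearMap.sum_apply]
    congr 1
    refine Finset.sum_congr rfl fun i _ => ?_
    rw [map_smul, LinearMap.smul_apply, hl]
    rfl

/-- Fixing all but the last argument of `nBr` amounts to left multiplication by a homogeneous
element, up to a power of `α`. -/
theorem IsHomLieSuper.exists_nBr_snoc (hg : IsHomLieSuper gr br α)
    (hmult : ∀ u v : W, α (br u v) = br (α u) (α v)) (p : ℕ)
    (d : Fin (p + 1) → ZMod 2) (x : Fin (p + 1) → W) (hx : ∀ i, x i ∈ gr (d i)) :
    ∃ u ∈ gr (∑ i, d i), ∀ (k : ℕ) (z : W),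
      nBr br α p (Fin.snoc (fun i => (α ^ k) (x i)) z) = br ((α ^ k) u) ((α ^ p) z) := by
  cases p with
  | zero => exact ⟨x 0, by simpa using hx 0, fun k z => by simp [nBr, Fin.snoc]⟩
  | succ p =>
    refine ⟨nBr br α p x, hg.nBr_even p d x hx, fun k z => ?_⟩
    simp only [nBr, Fin.init_snoc, Fin.snoc_last, pow_apply_nBr hmult]

end HomLieSuperalgebra

theorem stmt8 (p : ℕ) (gr : ZMod 2 → Submodule K V) (br : V →ₗ[K] V →ₗ[K] V)
    (α : Module.End K V) (hg : IsHomLieSuper gr br α)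
    (hmult : ∀ u v : V, α (br u v) = br (α u) (α v)) :
    IsMultNaryHomNambuSuper gr (nBr br α p) (α ^ (p + 1)) := by
  refine ⟨⟨hg.internal, fun a x hx => hg.pow_alpha_even _ hx, nBr_update_add p, nBr_update_smul p,
    hg.nBr_even p, fun dx x dy y hx hy => ?_⟩, pow_apply_nBr hmult _ p⟩
  obtain ⟨u, hu, hux⟩ := hg.exists_nBr_snoc hmult p dx x hx
  have hux₀ : ∀ z, nBr br α p (Fin.snoc x z) = br u ((α ^ p) z) := by simpa using hux 0
  rw [hux, pow_apply_nBr hmult,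
    hg.br_nBr hmult p hu dy _ fun i => hg.pow_alpha_even p (hy i)]
  simp only [hux₀, pow_succ', Module.End.mul_apply]

end NHomSuper
end
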